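/- The subspaces 𝔽ᵢ = {F admissible : F = Fᵢ} (i = 1,…,11) of the real vector space 𝔽 of admissible tensors on V have the following dimensions: dim 𝔽₁ = 2n, dim 𝔽₂ = n(n−1)(n+2), dim 𝔽₃ = n²(n−1), dim 𝔽₄ = 1, dim 𝔽₅ = 1, dim 𝔽₆ = (n−1)(n+2), dim 𝔽₇ = n(n−1), dim 𝔽₈ = n², dim 𝔽₉ = n², dim 𝔽₁₀ = n², dim 𝔽₁₁ = 2n. -/

import Mathlib

set_option maxSynthPendingDepth 3
set_option synthInstance.maxHeartbeats 1000000
set_option maxHeartbeats 1000000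

open scoped RealInnerProductSpace

noncomputable section

/-- An almost paracontact almost paracomplex structure compatible with the inner
product on a real inner product space `V` of dimension `2 * n + 1`. -/
structure APAP (n : ℕ) (V : Type*) [NormedAddCommGroup V] [InnerProductSpace ℝ V] where
  phi : V →ₗ[ℝ] V
  xi : V
  eta : V →ₗ[ℝ] ℝ
  dim_eq : Module.finrank ℝ V = 2 * n + 1
  phi_xi : phi xi = 0
  phi_phi : ∀ x : V, phi (phi x) = x - eta x • xi
  eta_phi : ∀ x : V, eta (phi x) = 0
  eta_xi : eta xi = 1
  trace_phi : LinearMap.trace ℝ V phi = 0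
  compat : ∀ x y : V, ⟪phi x, phi y⟫ = ⟪x, y⟫ - eta x * eta y
  inner_xi : ∀ x : V, ⟪x, xi⟫ = eta x

variable {n : ℕ} {V : Type*} [NormedAddCommGroup V] [InnerProductSpace ℝ V]

/-- The defining symmetries of the fundamental tensor `F`. -/
def APAP.Admissible (S : APAP n V) (F : V →ₗ[ℝ] V →ₗ[ℝ] V →ₗ[ℝ] ℝ) : Prop :=
  (∀ x y z : V, F x y z = F x z y) ∧
  (∀ x y z : V, F x y z =
    -F x (S.phi y) (S.phi z) + S.eta y * F x S.xi z + S.eta z * F x y S.xi)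

/-- The Nijenhuis tensor of `F`. -/
def APAP.nij (S : APAP n V) (F : V →ₗ[ℝ] V →ₗ[ℝ] V →ₗ[ℝ] ℝ) (x y z : V) : ℝ :=
  F (S.phi x) y z - F (S.phi y) x z - F x y (S.phi z) + F y x (S.phi z)
    + S.eta z * (F x (S.phi y) S.xi - F y (S.phi x) S.xi)

/-- The associated Nijenhuis tensor of `F`. -/
def APAP.nijA (S : APAP n V) (F : V →ₗ[ℝ] V →ₗ[ℝ] V →ₗ[ℝ] ℝ) (x y z : V) : ℝ :=
  F (S.phi x) y z + F (S.phi y) x z - F x y (S.phi z) - F y x (S.phi z)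
    + S.eta z * (F x (S.phi y) S.xi + F y (S.phi x) S.xi)

/-- The Lee form `θ` of `F` with respect to an orthonormal basis. -/
def APAP.leeTheta (S : APAP n V) (b : OrthonormalBasis (Fin (2 * n + 1)) ℝ V)
    (F : V →ₗ[ℝ] V →ₗ[ℝ] V →ₗ[ℝ] ℝ) (z : V) : ℝ :=
  ∑ i, F (b i) (b i) z

/-- The Lee form `θ*` of `F` with respect to an orthonormal basis. -/
def APAP.leeThetaStar (S : APAP n V) (b : OrthonormalBasis (Fin (2 * n + 1)) ℝ V)
    (F : V →ₗ[ℝ] V →ₗ[ℝ] V →ₗ[ℝ] ℝ) (z : V) : ℝ :=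
  ∑ i, F (b i) (S.phi (b i)) z

/-- The Lee form `ω` of `F`. -/
def APAP.leeOmega (S : APAP n V) (F : V →ₗ[ℝ] V →ₗ[ℝ] V →ₗ[ℝ] ℝ) (z : V) : ℝ :=
  F S.xi S.xi z

/-- The component `F₁` of `F`. -/
def APAP.comp1 (S : APAP n V) (b : OrthonormalBasis (Fin (2 * n + 1)) ℝ V)
    (F : V →ₗ[ℝ] V →ₗ[ℝ] V →ₗ[ℝ] ℝ) (x y z : V) : ℝ :=
  (1 / (2 * (n : ℝ))) *
    (⟪S.phi x, S.phi y⟫ * S.leeTheta b F (S.phi (S.phi z))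
      + ⟪S.phi x, S.phi z⟫ * S.leeTheta b F (S.phi (S.phi y))
      - ⟪x, S.phi y⟫ * S.leeTheta b F (S.phi z)
      - ⟪x, S.phi z⟫ * S.leeTheta b F (S.phi y))

/-- The component `F₂` of `F`. -/
def APAP.comp2 (S : APAP n V) (b : OrthonormalBasis (Fin (2 * n + 1)) ℝ V)
    (F : V →ₗ[ℝ] V →ₗ[ℝ] V →ₗ[ℝ] ℝ) (x y z : V) : ℝ :=
  (1 / 4) * (2 * F (S.phi (S.phi x)) (S.phi (S.phi y)) (S.phi (S.phi z))
      + F (S.phi (S.phi y)) (S.phi (S.phi z)) (S.phi (S.phi x))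
      + F (S.phi (S.phi z)) (S.phi (S.phi x)) (S.phi (S.phi y))
      - F (S.phi y) (S.phi z) (S.phi (S.phi x))
      - F (S.phi z) (S.phi y) (S.phi (S.phi x)))
    - S.comp1 b F x y z

/-- The component `F₃` of `F`. -/
def APAP.comp3 (S : APAP n V)
    (F : V →ₗ[ℝ] V →ₗ[ℝ] V →ₗ[ℝ] ℝ) (x y z : V) : ℝ :=
  (1 / 4) * (2 * F (S.phi (S.phi x)) (S.phi (S.phi y)) (S.phi (S.phi z))
      - F (S.phi (S.phi y)) (S.phi (S.phi z)) (S.phi (S.phi x))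
      - F (S.phi (S.phi z)) (S.phi (S.phi x)) (S.phi (S.phi y))
      + F (S.phi y) (S.phi z) (S.phi (S.phi x))
      + F (S.phi z) (S.phi y) (S.phi (S.phi x)))

/-- The component `F₄` of `F`. -/
def APAP.comp4 (S : APAP n V) (b : OrthonormalBasis (Fin (2 * n + 1)) ℝ V)
    (F : V →ₗ[ℝ] V →ₗ[ℝ] V →ₗ[ℝ] ℝ) (x y z : V) : ℝ :=
  (S.leeTheta b F S.xi / (2 * (n : ℝ))) *
    (⟪S.phi x, S.phi y⟫ * S.eta z + ⟪S.phi x, S.phi z⟫ * S.eta y)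

/-- The component `F₅` of `F`. -/
def APAP.comp5 (S : APAP n V) (b : OrthonormalBasis (Fin (2 * n + 1)) ℝ V)
    (F : V →ₗ[ℝ] V →ₗ[ℝ] V →ₗ[ℝ] ℝ) (x y z : V) : ℝ :=
  (S.leeThetaStar b F S.xi / (2 * (n : ℝ))) *
    (⟪x, S.phi y⟫ * S.eta z + ⟪x, S.phi z⟫ * S.eta y)

/-- The component `F₆` of `F`. -/
def APAP.comp6 (S : APAP n V) (b : OrthonormalBasis (Fin (2 * n + 1)) ℝ V)
    (F : V →ₗ[ℝ] V →ₗ[ℝ] V →ₗ[ℝ] ℝ) (x y z : V) : ℝ :=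
  (1 / 4) * ((F (S.phi (S.phi x)) (S.phi (S.phi y)) S.xi + F (S.phi (S.phi y)) (S.phi (S.phi x)) S.xi
        + F (S.phi x) (S.phi y) S.xi + F (S.phi y) (S.phi x) S.xi) * S.eta z
      + (F (S.phi (S.phi x)) (S.phi (S.phi z)) S.xi + F (S.phi (S.phi z)) (S.phi (S.phi x)) S.xi
        + F (S.phi x) (S.phi z) S.xi + F (S.phi z) (S.phi x) S.xi) * S.eta y)
    - S.comp4 b F x y z - S.comp5 b F x y z

/-- The component `F₇` of `F`. -/
def APAP.comp7 (S : APAP n V)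
    (F : V →ₗ[ℝ] V →ₗ[ℝ] V →ₗ[ℝ] ℝ) (x y z : V) : ℝ :=
  (1 / 4) * ((F (S.phi (S.phi x)) (S.phi (S.phi y)) S.xi - F (S.phi (S.phi y)) (S.phi (S.phi x)) S.xi
        + F (S.phi x) (S.phi y) S.xi - F (S.phi y) (S.phi x) S.xi) * S.eta z
      + (F (S.phi (S.phi x)) (S.phi (S.phi z)) S.xi - F (S.phi (S.phi z)) (S.phi (S.phi x)) S.xi
        + F (S.phi x) (S.phi z) S.xi - F (S.phi z) (S.phi x) S.xi) * S.eta y)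

/-- The component `F₈` of `F`. -/
def APAP.comp8 (S : APAP n V)
    (F : V →ₗ[ℝ] V →ₗ[ℝ] V →ₗ[ℝ] ℝ) (x y z : V) : ℝ :=
  (1 / 4) * ((F (S.phi (S.phi x)) (S.phi (S.phi y)) S.xi + F (S.phi (S.phi y)) (S.phi (S.phi x)) S.xi
        - F (S.phi x) (S.phi y) S.xi - F (S.phi y) (S.phi x) S.xi) * S.eta z
      + (F (S.phi (S.phi x)) (S.phi (S.phi z)) S.xi + F (S.phi (S.phi z)) (S.phi (S.phi x)) S.xi
        - F (S.phi x) (S.phi z) S.xi - F (S.phi z) (S.phi x) S.xi) * S.eta y)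

/-- The component `F₉` of `F`. -/
def APAP.comp9 (S : APAP n V)
    (F : V →ₗ[ℝ] V →ₗ[ℝ] V →ₗ[ℝ] ℝ) (x y z : V) : ℝ :=
  (1 / 4) * ((F (S.phi (S.phi x)) (S.phi (S.phi y)) S.xi - F (S.phi (S.phi y)) (S.phi (S.phi x)) S.xi
        - F (S.phi x) (S.phi y) S.xi + F (S.phi y) (S.phi x) S.xi) * S.eta z
      + (F (S.phi (S.phi x)) (S.phi (S.phi z)) S.xi - F (S.phi (S.phi z)) (S.phi (S.phi x)) S.xi
        - F (S.phi x) (S.phi z) S.xi + F (S.phi z) (S.phi x) S.xi) * S.eta y)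

/-- The component `F₁₀` of `F`. -/
def APAP.comp10 (S : APAP n V)
    (F : V →ₗ[ℝ] V →ₗ[ℝ] V →ₗ[ℝ] ℝ) (x y z : V) : ℝ :=
  S.eta x * F S.xi (S.phi (S.phi y)) (S.phi (S.phi z))

/-- The component `F₁₁` of `F`. -/
def APAP.comp11 (S : APAP n V)
    (F : V →ₗ[ℝ] V →ₗ[ℝ] V →ₗ[ℝ] ℝ) (x y z : V) : ℝ :=
  S.eta x * (S.eta y * S.leeOmega F z + S.eta z * S.leeOmega F y)

section SymmetricFamilies

variable (ι E : Type*) [AddCommGroup E] [Module ℝ E]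

/-- Families `f : ι → ι → E` symmetric in the two indices. -/
def symFamilies : Submodule ℝ (ι → ι → E) where
  carrier := {f | ∀ i j, f i j = f j i}
  zero_mem' _ _ := rfl
  add_mem' {f g} hf hg i j := by simp [hf i j, hg i j]
  smul_mem' c f hf i j := by simp [hf i j]

/-- Families `f : ι → ι → E` skew-symmetric in the two indices. -/
def skewFamilies : Submodule ℝ (ι → ι → E) where
  carrier := {f | ∀ i j, f i j = -f j i}
  zero_mem' _ _ := by simp
  add_mem' {f g} hf hg i j := by simp [hf i j, hg i j, add_comm]
  smul_mem' c f hf i j := by simp [hf i j]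

lemma isCompl_symFamilies_skewFamilies : IsCompl (symFamilies ι E) (skewFamilies ι E) := by
  refine ⟨?_, ?_⟩
  · rw [Submodule.disjoint_def]
    intro f hf hg
    funext i j
    have h1 : f i j = f j i := hf i j
    have h2 : f i j = -f j i := hg i j
    rw [← h1] at h2
    have h3 : (2 : ℝ) • f i j = 0 := by
      rw [two_smul]
      exact eq_neg_iff_add_eq_zero.mp h2
    exact (smul_eq_zero.mp h3).resolve_left two_ne_zero
  · rw [codisjoint_iff, Submodule.eq_top_iff']
    intro f
    refine Submodule.mem_sup.mpr
      ⟨fun i j => (1 / 2 : ℝ) • (f i j + f j i), fun i j => by simp [add_comm],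
        fun i j => (1 / 2 : ℝ) • (f i j - f j i), fun i j => ?_, ?_⟩
    · simp [← smul_neg]
    · funext i j
      simp only [Pi.add_apply]
      module

variable [Fintype ι]

/-- Symmetric families `f : ι → ι → E` with vanishing trace. -/
def tracelessFamilies : Submodule ℝ (ι → ι → E) where
  carrier := {f | (∀ i j, f i j = f j i) ∧ ∑ i, f i i = 0}
  zero_mem' := by simp
  add_mem' {f g} hf hg :=
    ⟨fun i j => by simp [hf.1 i j, hg.1 i j], by simp [Finset.sum_add_distrib, hf.2, hg.2]⟩
  smul_mem' c f hf := ⟨fun i j => by simp [hf.1 i j], by simp [← Finset.smul_sum, hf.2]⟩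

/-- Symmetric families are functions on unordered pairs. -/
def symFamiliesEquiv : symFamilies ι E ≃ₗ[ℝ] (Sym2 ι → E) where
  __ := (Sym2.lift : { f : ι → ι → E // ∀ a₁ a₂, f a₁ a₂ = f a₂ a₁ } ≃ (Sym2 ι → E))
  map_add' f g := by
    funext s
    induction s with | _ a b => rfl
  map_smul' c f := by
    funext s
    induction s with | _ a b => rfl

/-- The trace of a symmetric family. -/
def symFamiliesTrace : symFamilies ι E →ₗ[ℝ] E where
  toFun f := ∑ i, f.1 i i
  map_add' f g := by simp [Finset.sum_add_distrib]
  map_smul' c f := by simp [Finset.smul_sum]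

variable [FiniteDimensional ℝ E]

lemma finrank_symFamilies :
    Module.finrank ℝ (symFamilies ι E) =
      (Fintype.card ι + 1).choose 2 * Module.finrank ℝ E := by
  classical
  rw [(symFamiliesEquiv ι E).finrank_eq, Module.finrank_pi_fintype, Finset.sum_const,
    Finset.card_univ, Sym2.card, smul_eq_mul]

lemma finrank_skewFamilies :
    Module.finrank ℝ (skewFamilies ι E) = (Fintype.card ι).choose 2 * Module.finrank ℝ E := by
  have h := Submodule.finrank_add_eq_of_isCompl (isCompl_symFamilies_skewFamilies ι E)
  rw [finrank_symFamilies, Module.finrank_pi_fintype, Finset.sum_const, Finset.card_univ,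
    Module.finrank_pi_fintype, Finset.sum_const, Finset.card_univ, smul_eq_mul, smul_eq_mul] at h
  have h2 : (Fintype.card ι + 1).choose 2 + (Fintype.card ι).choose 2 =
      Fintype.card ι * Fintype.card ι := by
    generalize Fintype.card ι = m
    induction m with
    | zero => rfl
    | succ m ih =>
      have h1 := Nat.choose_succ_succ (m + 1) 1
      have h2 := Nat.choose_succ_succ m 1
      simp only [Nat.choose_one_right, Nat.succ_eq_add_one, Nat.reduceAdd] at h1 h2
      rw [h1]
      nlinarith
  rw [← mul_assoc, ← h2, add_mul] at h
  omega

lemma finrank_tracelessFamilies [Nonempty ι] :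
    Module.finrank ℝ (tracelessFamilies ι E) + Module.finrank ℝ E =
      (Fintype.card ι + 1).choose 2 * Module.finrank ℝ E := by
  classical
  have hsurj : LinearMap.range (symFamiliesTrace ι E) = ⊤ := by
    rw [LinearMap.range_eq_top]
    intro v
    obtain ⟨a⟩ := ‹Nonempty ι›
    refine ⟨⟨fun i j => if i = a ∧ j = a then v else 0, fun i j => by simp [and_comm]⟩, ?_⟩
    simp [symFamiliesTrace]
  have hker : (LinearMap.ker (symFamiliesTrace ι E)).map (symFamilies ι E).subtype =
      tracelessFamilies ι E := by
    ext f
    simp only [Submodule.mem_map, LinearMap.mem_ker, Submodule.subtype_apply]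
    constructor
    · rintro ⟨g, hg, rfl⟩
      exact ⟨g.2, hg⟩
    · rintro ⟨h1, h2⟩
      exact ⟨⟨f, h1⟩, h2, rfl⟩
  have h := LinearMap.finrank_range_add_finrank_ker (symFamiliesTrace ι E)
  rw [hsurj, finrank_top, finrank_symFamilies,
    ← Submodule.finrank_map_subtype_eq, hker] at h
  omega

end SymmetricFamilies

section AdaptedBasis

lemma APAP.inner_phi_right (S : APAP n V) (x y : V) : ⟪x, S.phi y⟫ = ⟪S.phi x, y⟫ := by
  have h := S.compat x (S.phi y)
  rw [S.phi_phi, S.eta_phi, mul_zero, sub_zero, inner_sub_right, inner_smul_right, S.inner_xi,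
    S.eta_phi, mul_zero, sub_zero] at h
  exact h.symm

/-- The sign `± 1` attached to a boolean. -/
def boolSign (s : Bool) : ℝ := if s then 1 else -1

@[simp] lemma boolSign_true : boolSign true = 1 := rfl

@[simp] lemma boolSign_false : boolSign false = -1 := rfl

lemma boolSign_mul_self (s : Bool) : boolSign s * boolSign s = 1 := by
  cases s <;> simp

lemma APAP.trace_phi_comp_phi (S : APAP n V) : LinearMap.trace ℝ V (S.phi ∘ₗ S.phi) = 2 * n := by
  have : FiniteDimensional ℝ V := Module.finite_of_finrank_pos (by rw [S.dim_eq]; omega)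
  have h : S.phi ∘ₗ S.phi = LinearMap.id - S.eta.smulRight S.xi := by
    ext x
    simp [S.phi_phi]
  rw [h, map_sub, LinearMap.trace_id, LinearMap.trace_smulRight, S.eta_xi, S.dim_eq]
  push_cast
  ring

lemma APAP.eta_eq_zero_of_mem_eigenspace (S : APAP n V) {s : Bool} {x : V}
    (hx : x ∈ Module.End.eigenspace S.phi (boolSign s)) : S.eta x = 0 := by
  rw [Module.End.mem_eigenspace_iff] at hx
  have h := S.eta_phi x
  rw [hx, map_smul, smul_eq_mul] at h
  cases s <;> simpa using h

lemma APAP.finrank_eigenspace (S : APAP n V) (s : Bool) :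
    Module.finrank ℝ (Module.End.eigenspace S.phi (boolSign s)) = n := by
  have : FiniteDimensional ℝ V := Module.finite_of_finrank_pos (by rw [S.dim_eq]; omega)
  have h : LinearMap.IsProj (Module.End.eigenspace S.phi (boolSign s))
      ((1 / 2 : ℝ) • (S.phi ∘ₗ S.phi + boolSign s • S.phi)) := by
    constructor
    · intro x
      rw [Module.End.mem_eigenspace_iff]
      have h3 : S.phi (S.phi (S.phi x)) = S.phi x := by
        rw [S.phi_phi, S.eta_phi, zero_smul, sub_zero]
      simp only [LinearMap.smul_apply, LinearMap.add_apply, LinearMap.comp_apply, map_smul,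
        map_add, h3]
      cases s <;> simp <;> abel
    · intro x hx
      rw [Module.End.mem_eigenspace_iff] at hx
      simp only [LinearMap.smul_apply, LinearMap.add_apply, LinearMap.comp_apply, map_smul, hx,
        smul_smul, boolSign_mul_self]
      module
  have ht := h.trace
  rw [map_smul, map_add, map_smul, S.trace_phi, S.trace_phi_comp_phi] at ht
  have : (n : ℝ) = Module.finrank ℝ (Module.End.eigenspace S.phi (boolSign s)) := by
    rw [← ht]
    simp
  exact_mod_cast this.symm

/-- An orthonormal basis is adapted if it is formed by `ξ` and eigenvectors of `φ`. -/
structure APAP.IsAdapted (S : APAP n V)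
    (e : OrthonormalBasis (Option (Bool × Fin n)) ℝ V) : Prop where
  none_eq : e none = S.xi
  phi_some : ∀ s i, S.phi (e (some (s, i))) = boolSign s • e (some (s, i))

lemma APAP.exists_isAdapted (S : APAP n V) :
    ∃ e : OrthonormalBasis (Option (Bool × Fin n)) ℝ V, S.IsAdapted e := by
  have : FiniteDimensional ℝ V := Module.finite_of_finrank_pos (by rw [S.dim_eq]; omega)
  let u (s : Bool) := (stdOrthonormalBasis ℝ (Module.End.eigenspace S.phi (boolSign s))).reindex
    (finCongr (S.finrank_eigenspace s))
  let v : Option (Bool × Fin n) → V := fun a => a.elim S.xi fun p => u p.1 p.2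
  have hu (s : Bool) (i : Fin n) : S.phi (u s i : V) = boolSign s • (u s i : V) :=
    Module.End.mem_eigenspace_iff.mp (u s i).2
  have heta (s : Bool) (i : Fin n) : S.eta (u s i : V) = 0 :=
    S.eta_eq_zero_of_mem_eigenspace (u s i).2
  have hdiag (s : Bool) (i j : Fin n) : ⟪(u s i : V), (u s j : V)⟫ = if i = j then 1 else 0 :=
    (u s).inner_eq_ite i j
  have hoff (i j : Fin n) : ⟪(u true i : V), (u false j : V)⟫ = 0 := by
    have h := S.inner_phi_right (u true i : V) (u false j)
    rw [hu, hu, real_inner_smul_left, real_inner_smul_right] at h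
    replace h : (-1 : ℝ) * ⟪(u true i : V), (u false j : V)⟫ =
      1 * ⟪(u true i : V), (u false j : V)⟫ := h
    linarith
  have hv : Orthonormal ℝ v := by
    rw [orthonormal_iff_ite]
    rintro (_ | ⟨s, i⟩) (_ | ⟨t, j⟩)
    · exact (S.inner_xi S.xi).trans S.eta_xi
    · exact (real_inner_comm _ _).trans ((S.inner_xi _).trans (heta t j))
    · exact (S.inner_xi _).trans (heta s i)
    · change ⟪(u s i : V), (u t j : V)⟫ = _
      cases s <;> cases t
      · rw [hdiag]
        simp
      · rw [real_inner_comm, hoff]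
        simp
      · rw [hoff]
        simp
      · rw [hdiag]
        simp
  have hcard : Fintype.card (Option (Bool × Fin n)) = Module.finrank ℝ V := by
    simp [S.dim_eq]
  have hspan : ⊤ ≤ Submodule.span ℝ (Set.range v) :=
    (hv.linearIndependent.span_eq_top_of_card_eq_finrank' hcard).ge
  refine ⟨OrthonormalBasis.mk hv hspan, ⟨by simp [v], fun s i => ?_⟩⟩
  simpa [v] using hu s i

namespace APAP.IsAdapted

variable {S : APAP n V} {e : OrthonormalBasis (Option (Bool × Fin n)) ℝ V}

lemma phi_none (he : S.IsAdapted e) : S.phi (e none) = 0 := by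
  rw [he.none_eq, S.phi_xi]

lemma phi_true (he : S.IsAdapted e) (i : Fin n) :
    S.phi (e (some (true, i))) = e (some (true, i)) := by
  simp [he.phi_some]

lemma phi_false (he : S.IsAdapted e) (i : Fin n) :
    S.phi (e (some (false, i))) = -e (some (false, i)) := by
  simp [he.phi_some]

lemma eta_none (he : S.IsAdapted e) : S.eta (e none) = 1 := by
  rw [he.none_eq, S.eta_xi]

lemma eta_some (he : S.IsAdapted e) (p : Bool × Fin n) : S.eta (e (some p)) = 0 := by
  rw [← S.inner_xi, ← he.none_eq, e.inner_eq_ite]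
  simp

end APAP.IsAdapted

end AdaptedBasis

section Coordinates

/-- A real function of three vectors which is linear in each of them. -/
structure IsTrilinear (f : V → V → V → ℝ) : Prop where
  add_left : ∀ x x' y z, f (x + x') y z = f x y z + f x' y z
  smul_left : ∀ (c : ℝ) x y z, f (c • x) y z = c * f x y z
  add_mid : ∀ x y y' z, f x (y + y') z = f x y z + f x y' z
  smul_mid : ∀ (c : ℝ) x y z, f x (c • y) z = c * f x y z
  add_right : ∀ x y z z', f x y (z + z') = f x y z + f x y z'
  smul_right : ∀ (c : ℝ) x y z, f x y (c • z) = c * f x y z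

/-- The bundled trilinear form given by a trilinear function. -/
def IsTrilinear.toLinearMap {f : V → V → V → ℝ} (hf : IsTrilinear f) :
    V →ₗ[ℝ] V →ₗ[ℝ] V →ₗ[ℝ] ℝ where
  toFun x := LinearMap.mk₂ ℝ (f x) (hf.add_mid x) (fun c => hf.smul_mid c x)
    (hf.add_right x) (fun c => hf.smul_right c x)
  map_add' x x' := by
    ext y z
    exact hf.add_left x x' y z
  map_smul' c x := by
    ext y z
    exact hf.smul_left c x y z

lemma trilinear_ext_basis {κ : Type*} (e : Module.Basis κ ℝ V)
    {F G : V →ₗ[ℝ] V →ₗ[ℝ] V →ₗ[ℝ] ℝ}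
    (h : ∀ i j k, F (e i) (e j) (e k) = G (e i) (e j) (e k)) : F = G :=
  e.ext fun i => e.ext fun j => e.ext fun k => h i j k

lemma IsTrilinear.forall_eq_iff {κ : Type*} (e : Module.Basis κ ℝ V) {f : V → V → V → ℝ}
    (hf : IsTrilinear f) (F : V →ₗ[ℝ] V →ₗ[ℝ] V →ₗ[ℝ] ℝ) :
    (∀ x y z, F x y z = f x y z) ↔
      ∀ i j k, F (e i) (e j) (e k) = f (e i) (e j) (e k) := by
  refine ⟨fun h i j k => h _ _ _, fun h x y z => ?_⟩
  have hF : F = hf.toLinearMap := trilinear_ext_basis e h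
  rw [hF]
  rfl

/-- Trilinear forms are determined by arbitrary coordinates in a basis. -/
def tensorOfCoords {κ : Type*} (e : Module.Basis κ ℝ V) :
    (κ → κ → κ → ℝ) ≃ₗ[ℝ] (V →ₗ[ℝ] V →ₗ[ℝ] V →ₗ[ℝ] ℝ) :=
  (LinearEquiv.piCongrRight fun _ =>
    (LinearEquiv.piCongrRight fun _ => e.constr ℝ) ≪≫ₗ e.constr ℝ) ≪≫ₗ e.constr ℝ

lemma tensorOfCoords_basis {κ : Type*} (e : Module.Basis κ ℝ V) (c : κ → κ → κ → ℝ)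
    (i j k : κ) : tensorOfCoords e c (e i) (e j) (e k) = c i j k := by
  simp [tensorOfCoords, Module.Basis.constr_basis]

/-- A class of tensors whose coordinates are parametrized linearly and injectively by `X` is a
subspace of dimension `dim X`. -/
lemma exists_submodule_of_coords {κ : Type*} (e : Module.Basis κ ℝ V)
    {X : Type*} [AddCommGroup X] [Module ℝ X]
    (L : X →ₗ[ℝ] (κ → κ → κ → ℝ)) (hL : Function.Injective L) {d : ℕ}
    (hd : Module.finrank ℝ X = d)
    (P : (V →ₗ[ℝ] V →ₗ[ℝ] V →ₗ[ℝ] ℝ) → Prop)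
    (h : ∀ F, P F ↔ ∃ x, ∀ i j k, F (e i) (e j) (e k) = L x i j k) :
    ∃ W : Submodule ℝ (V →ₗ[ℝ] V →ₗ[ℝ] V →ₗ[ℝ] ℝ),
      (W : Set (V →ₗ[ℝ] V →ₗ[ℝ] V →ₗ[ℝ] ℝ)) = {F | P F} ∧ Module.finrank ℝ W = d := by
  refine ⟨LinearMap.range ((tensorOfCoords e).toLinearMap ∘ₗ L), ?_, ?_⟩
  · ext F
    simp only [SetLike.mem_coe, LinearMap.mem_range, Set.mem_ofPred_eq, h]
    refine exists_congr fun x => ⟨?_, fun hx => ?_⟩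
    · rintro rfl i j k
      exact tensorOfCoords_basis e _ i j k
    · refine trilinear_ext_basis e fun i j k => ?_
      rw [hx]
      exact tensorOfCoords_basis e _ i j k
  · rw [LinearMap.finrank_range_of_inj, hd]
    exact (tensorOfCoords e).injective.comp hL

/-- The contraction of a bilinear form is independent of the orthonormal basis. -/
lemma sum_bilin_orthonormalBasis {ι κ : Type*} [Fintype ι] [Fintype κ]
    (b : OrthonormalBasis ι ℝ V) (e : OrthonormalBasis κ ℝ V) (B : V →ₗ[ℝ] V →ₗ[ℝ] ℝ) :
    ∑ i, B (b i) (b i) = ∑ j, B (e j) (e j) := by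
  have h (i : ι) : B (b i) (b i) = ∑ j, ⟪e j, b i⟫ * B (e j) (b i) := by
    simpa using congrArg (fun v => B v (b i)) (e.sum_repr' (b i)).symm
  have h' (j : κ) : B (e j) (e j) = ∑ i, ⟪b i, e j⟫ * B (e j) (b i) := by
    simpa using congrArg (B (e j)) (b.sum_repr' (e j)).symm
  simp_rw [h, h']
  rw [Finset.sum_comm]
  simp_rw [real_inner_comm]

end Coordinates

section Classes

namespace APAP

variable (S : APAP n V) (b : OrthonormalBasis (Fin (2 * n + 1)) ℝ V)
  (F : V →ₗ[ℝ] V →ₗ[ℝ] V →ₗ[ℝ] ℝ)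

lemma leeTheta_add (z z' : V) :
    S.leeTheta b F (z + z') = S.leeTheta b F z + S.leeTheta b F z' := by
  simp [leeTheta, Finset.sum_add_distrib]

lemma leeTheta_smul (c : ℝ) (z : V) : S.leeTheta b F (c • z) = c * S.leeTheta b F z := by
  simp [leeTheta, Finset.mul_sum]

lemma leeTheta_zero : S.leeTheta b F 0 = 0 := by
  simp [leeTheta]

lemma leeTheta_neg (z : V) : S.leeTheta b F (-z) = -S.leeTheta b F z := by
  simp [leeTheta]

lemma isTrilinear_comp1 : IsTrilinear (S.comp1 b F) := by
  constructor <;> intros <;>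
    simp only [comp1, map_add, map_smul, inner_add_left, inner_add_right, real_inner_smul_left,
      real_inner_smul_right, leeTheta_add, leeTheta_smul] <;> ring

lemma isTrilinear_comp2 : IsTrilinear (S.comp2 b F) := by
  have h := S.isTrilinear_comp1 b F
  constructor <;> intros <;>
    simp only [comp2, h.add_left, h.smul_left, h.add_mid, h.smul_mid, h.add_right, h.smul_right,
      map_add, map_smul, LinearMap.add_apply, LinearMap.smul_apply, smul_eq_mul] <;> ring

lemma isTrilinear_comp3 : IsTrilinear (S.comp3 F) := by
  constructor <;> intros <;>
    simp only [comp3, map_add, map_smul, LinearMap.add_apply, LinearMap.smul_apply,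
      smul_eq_mul] <;> ring

lemma isTrilinear_comp4 : IsTrilinear (S.comp4 b F) := by
  constructor <;> intros <;>
    simp only [comp4, map_add, map_smul, inner_add_left, inner_add_right, real_inner_smul_left,
      real_inner_smul_right, smul_eq_mul] <;> ring

lemma isTrilinear_comp5 : IsTrilinear (S.comp5 b F) := by
  constructor <;> intros <;>
    simp only [comp5, map_add, map_smul, inner_add_left, inner_add_right, real_inner_smul_left,
      real_inner_smul_right, smul_eq_mul] <;> ring

lemma isTrilinear_comp6 : IsTrilinear (S.comp6 b F) := by
  have h := S.isTrilinear_comp4 b F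
  have h' := S.isTrilinear_comp5 b F
  constructor <;> intros <;>
    simp only [comp6, h.add_left, h.smul_left, h.add_mid, h.smul_mid, h.add_right, h.smul_right,
      h'.add_left, h'.smul_left, h'.add_mid, h'.smul_mid, h'.add_right, h'.smul_right,
      map_add, map_smul, LinearMap.add_apply, LinearMap.smul_apply, smul_eq_mul] <;> ring

lemma isTrilinear_comp7 : IsTrilinear (S.comp7 F) := by
  constructor <;> intros <;>
    simp only [comp7, map_add, map_smul, LinearMap.add_apply, LinearMap.smul_apply,
      smul_eq_mul] <;> ring

lemma isTrilinear_comp8 : IsTrilinear (S.comp8 F) := by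
  constructor <;> intros <;>
    simp only [comp8, map_add, map_smul, LinearMap.add_apply, LinearMap.smul_apply,
      smul_eq_mul] <;> ring

lemma isTrilinear_comp9 : IsTrilinear (S.comp9 F) := by
  constructor <;> intros <;>
    simp only [comp9, map_add, map_smul, LinearMap.add_apply, LinearMap.smul_apply,
      smul_eq_mul] <;> ring

lemma isTrilinear_comp10 : IsTrilinear (S.comp10 F) := by
  constructor <;> intros <;>
    simp only [comp10, map_add, map_smul, LinearMap.add_apply, LinearMap.smul_apply,
      smul_eq_mul] <;> ring

lemma isTrilinear_comp11 : IsTrilinear (S.comp11 F) := by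
  constructor <;> intros <;>
    simp only [comp11, leeOmega, map_add, map_smul, smul_eq_mul] <;> ring

variable {S} {e : OrthonormalBasis (Option (Bool × Fin n)) ℝ V} {F}

lemma leeTheta_eq (e : OrthonormalBasis (Option (Bool × Fin n)) ℝ V) (z : V) :
    S.leeTheta b F z = F (e none) (e none) z +
      (∑ i, F (e (some (true, i))) (e (some (true, i))) z +
        ∑ i, F (e (some (false, i))) (e (some (false, i))) z) := by
  have h := sum_bilin_orthonormalBasis b e (F.compr₂ (LinearMap.applyₗ z))
  simpa [leeTheta, Fintype.sum_option, Fintype.sum_prod_type] using h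

lemma IsAdapted.leeThetaStar_eq (he : S.IsAdapted e) (z : V) :
    S.leeThetaStar b F z =
      ∑ i, F (e (some (true, i))) (e (some (true, i))) z -
        ∑ i, F (e (some (false, i))) (e (some (false, i))) z := by
  have h := sum_bilin_orthonormalBasis b e ((F.compl₂ S.phi).compr₂ (LinearMap.applyₗ z))
  simpa [leeThetaStar, Fintype.sum_option, Fintype.sum_prod_type, he.phi_none, he.phi_true,
    he.phi_false, sub_eq_add_neg] using h

lemma IsAdapted.admissible_iff (he : S.IsAdapted e) :
    S.Admissible F ↔
      (∀ i j k, F (e i) (e j) (e k) = F (e i) (e k) (e j)) ∧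
      (∀ i s j k, F (e i) (e (some (s, j))) (e (some (s, k))) = 0) ∧
      ∀ i, F (e i) (e none) (e none) = 0 := by
  have h1 : (∀ x y z : V, F x y z = F x z y) ↔
      ∀ i j k, F (e i) (e j) (e k) = F (e i) (e k) (e j) :=
    IsTrilinear.forall_eq_iff e.toBasis (f := fun x y z => F x z y)
      (by constructor <;> intros <;> simp) F |>.trans (by simp)
  have h2 : (∀ x y z : V, F x y z = -F x (S.phi y) (S.phi z) + S.eta y * F x S.xi z +
      S.eta z * F x y S.xi) ↔ ∀ i j k, F (e i) (e j) (e k) =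
        -F (e i) (S.phi (e j)) (S.phi (e k)) + S.eta (e j) * F (e i) S.xi (e k) +
          S.eta (e k) * F (e i) (e j) S.xi :=
    IsTrilinear.forall_eq_iff e.toBasis
      (f := fun x y z => -F x (S.phi y) (S.phi z) + S.eta y * F x S.xi z +
        S.eta z * F x y S.xi)
      (by constructor <;> intros <;> simp <;> ring) F |>.trans (by simp)
  rw [Admissible, h1, h2]
  refine and_congr_right fun _ => ⟨fun h => ⟨fun i s j k => ?_, fun i => ?_⟩, ?_⟩
  · have h := h i (some (s, j)) (some (s, k))
    cases s <;>
      simp only [he.phi_true, he.phi_false, he.eta_some, map_neg, LinearMap.neg_apply,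
        neg_neg, zero_mul, add_zero] at h <;> linarith
  · have h := h i none none
    simp only [← he.none_eq, he.phi_none, he.eta_none, map_zero, one_mul] at h
    linarith
  · rintro ⟨h1, h2⟩ i (_ | ⟨_ | _, j⟩) (_ | ⟨_ | _, k⟩) <;>
      simp [← he.none_eq, he.phi_none, he.eta_none, he.phi_true, he.phi_false, he.eta_some,
        h1, h2]

variable {ι : Type*}

/-- Coordinates of the tensors on `ker η` assembled from their values on triples of
eigenvectors of `φ`, where the first two arguments are of the same type `s` and the third
one is of the opposite type. -/
def horizontalCoords : (Bool → ι → ι → ι → ℝ) →ₗ[ℝ]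
    (Option (Bool × ι) → Option (Bool × ι) → Option (Bool × ι) → ℝ) where
  toFun A
    | some (true, i), some (true, j), some (false, k) => A true i j k
    | some (true, i), some (false, k), some (true, j) => A true i j k
    | some (false, i), some (false, j), some (true, k) => A false i j k
    | some (false, i), some (true, k), some (false, j) => A false i j k
    | _, _, _ => 0
  map_add' A B := by
    funext i j k
    rcases i with _ | ⟨_ | _, i⟩ <;> rcases j with _ | ⟨_ | _, j⟩ <;>
      rcases k with _ | ⟨_ | _, k⟩ <;> simp
  map_smul' c A := by
    funext i j k
    rcases i with _ | ⟨_ | _, i⟩ <;> rcases j with _ | ⟨_ | _, j⟩ <;>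
      rcases k with _ | ⟨_ | _, k⟩ <;> simp

lemma horizontalCoords_injective :
    Function.Injective (horizontalCoords : (Bool → ι → ι → ι → ℝ) →ₗ[ℝ] _) := by
  intro A B h
  funext s i j k
  cases s
  · exact congrFun (congrFun (congrFun h (some (false, i))) (some (false, j))) (some (true, k))
  · exact congrFun (congrFun (congrFun h (some (true, i))) (some (true, j))) (some (false, k))

lemma IsAdapted.admissible_of_horizontalCoords (he : S.IsAdapted e)
    {A : Bool → Fin n → Fin n → Fin n → ℝ}
    (hF : ∀ i j k, F (e i) (e j) (e k) = horizontalCoords A i j k) : S.Admissible F := by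
  rw [he.admissible_iff]
  simp only [hF]
  refine ⟨?_, ?_, ?_⟩
  · rintro (_ | ⟨_ | _, i⟩) (_ | ⟨_ | _, j⟩) (_ | ⟨_ | _, k⟩) <;> simp [horizontalCoords]
  · rintro (_ | ⟨_ | _, i⟩) (_ | _) j k <;> simp [horizontalCoords]
  · rintro (_ | ⟨_ | _, i⟩) <;> simp [horizontalCoords]

lemma IsAdapted.eq_horizontalCoords (he : S.IsAdapted e) (hF : S.Admissible F)
    (hn1 : ∀ j k, F (e none) (e j) (e k) = 0) (hn3 : ∀ i j, F (e i) (e j) (e none) = 0)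
    (i j k : Option (Bool × Fin n)) :
    F (e i) (e j) (e k) = horizontalCoords
      (fun s i j k => F (e (some (s, i))) (e (some (s, j))) (e (some (!s, k)))) i j k := by
  obtain ⟨hs, h0, -⟩ := he.admissible_iff.mp hF
  have hs1 (a p) : F (e a) (e none) (e (some p)) = F (e a) (e (some p)) (e none) := hs _ _ _
  have hs2 (a i j) : F (e a) (e (some (false, i))) (e (some (true, j))) =
    F (e a) (e (some (true, j))) (e (some (false, i))) := hs _ _ _
  rcases i with _ | ⟨_ | _, i⟩ <;> rcases j with _ | ⟨_ | _, j⟩ <;>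
    rcases k with _ | ⟨_ | _, k⟩ <;> simp [horizontalCoords, h0, hn1, hn3, hs1, hs2]

lemma leeTheta_of_horizontalCoords {A : Bool → Fin n → Fin n → Fin n → ℝ}
    (hF : ∀ i j k, F (e i) (e j) (e k) = horizontalCoords A i j k) (s : Bool) (k : Fin n) :
    S.leeTheta b F (e (some (s, k))) = ∑ i, A (!s) i i k := by
  rw [leeTheta_eq b e]
  cases s <;> simp [hF, horizontalCoords]

lemma IsAdapted.class1_iff (hn : 1 ≤ n) (he : S.IsAdapted e) :
    (S.Admissible F ∧ ∀ x y z, F x y z = S.comp1 b F x y z) ↔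
      ∃ v : Bool → Fin n → ℝ, ∀ i j k, F (e i) (e j) (e k) =
        horizontalCoords (fun s i j k => if i = j then v s k else 0) i j k := by
  have hn0 : (n : ℝ) ≠ 0 := by positivity
  rw [(S.isTrilinear_comp1 b F).forall_eq_iff e.toBasis]
  simp only [OrthonormalBasis.coe_toBasis]
  constructor
  · rintro ⟨-, hc⟩
    refine ⟨fun s k => 1 / n * S.leeTheta b F (e (some (!s, k))), fun i j k => ?_⟩
    rw [hc]
    rcases i with _ | ⟨_ | _, i⟩ <;> rcases j with _ | ⟨_ | _, j⟩ <;>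
      rcases k with _ | ⟨_ | _, k⟩ <;>
      simp [comp1, he.phi_none, he.phi_true, he.phi_false, e.inner_eq_ite, horizontalCoords,
        leeTheta_neg, leeTheta_zero] <;>
      split_ifs <;> field
  · rintro ⟨v, hF⟩
    refine ⟨he.admissible_of_horizontalCoords hF, ?_⟩
    have hθ (s k) : S.leeTheta b F (e (some (s, k))) = n * v (!s) k := by
      rw [leeTheta_of_horizontalCoords b hF]
      simp
    rintro (_ | ⟨_ | _, i⟩) (_ | ⟨_ | _, j⟩) (_ | ⟨_ | _, k⟩) <;>
      simp [comp1, he.phi_none, he.phi_true, he.phi_false, hF, horizontalCoords, e.inner_eq_ite,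
        leeTheta_neg, leeTheta_zero, hθ] <;>
      split_ifs <;> field

lemma IsAdapted.class2_iff (hn : 1 ≤ n) (he : S.IsAdapted e) :
    (S.Admissible F ∧ ∀ x y z, F x y z = S.comp2 b F x y z) ↔
      ∃ x : Bool → tracelessFamilies (Fin n) (Fin n → ℝ), ∀ i j k,
        F (e i) (e j) (e k) = horizontalCoords (fun s => (x s).1) i j k := by
  have hn0 : (n : ℝ) ≠ 0 := by positivity
  rw [(S.isTrilinear_comp2 b F).forall_eq_iff e.toBasis]
  simp only [OrthonormalBasis.coe_toBasis]
  constructor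
  · rintro ⟨hadm, hc⟩
    obtain ⟨hs, h0, -⟩ := he.admissible_iff.mp hadm
    have hs2 (a i j) : F (e a) (e (some (false, i))) (e (some (true, j))) =
      F (e a) (e (some (true, j))) (e (some (false, i))) := hs _ _ _
    have hn1 (j k) : F (e none) (e j) (e k) = 0 := by
      rw [hc]
      simp only [comp2, comp1, he.phi_none, map_zero, LinearMap.zero_apply]
      rcases j with _ | ⟨_ | _, j⟩ <;> rcases k with _ | ⟨_ | _, k⟩ <;>
        simp [he.phi_none, he.phi_true, he.phi_false, e.inner_eq_ite]
    have hn3 (i j) : F (e i) (e j) (e none) = 0 := by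
      rw [hc]
      simp only [comp2, comp1, he.phi_none, map_zero, LinearMap.zero_apply]
      rcases i with _ | ⟨_ | _, i⟩ <;> rcases j with _ | ⟨_ | _, j⟩ <;>
        simp [he.phi_none, he.phi_true, he.phi_false, e.inner_eq_ite, leeTheta_zero]
    have hF := he.eq_horizontalCoords hadm hn1 hn3
    have hval (s : Bool) (i j k : Fin n) :
        F (e (some (s, i))) (e (some (s, j))) (e (some (!s, k))) =
          (1 / 2) * (F (e (some (s, i))) (e (some (s, j))) (e (some (!s, k))) +
            F (e (some (s, j))) (e (some (s, i))) (e (some (!s, k)))) -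
          (1 / n) * if i = j then S.leeTheta b F (e (some (!s, k))) else 0 := by
      have h1 := hc (some (s, i)) (some (s, j)) (some (!s, k))
      cases s <;>
        simp [comp2, comp1, he.phi_true, he.phi_false, h0, hs2, e.inner_eq_ite,
          leeTheta_neg] at h1 ⊢ <;> split_ifs at h1 ⊢ <;>
        first
        | simp only [mul_zero, sub_zero, add_zero] at h1 ⊢; linarith
        | field_simp at h1 ⊢; linarith
    have hsym (s : Bool) (i j k : Fin n) :
        F (e (some (s, i))) (e (some (s, j))) (e (some (!s, k))) =
          F (e (some (s, j))) (e (some (s, i))) (e (some (!s, k))) := by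
      have h1 := hval s i j k
      have h2 := hval s j i k
      simp only [eq_comm (a := j) (b := i)] at h2
      linarith
    have htr (s : Bool) (k : Fin n) :
        ∑ i, F (e (some (s, i))) (e (some (s, i))) (e (some (!s, k))) = 0 := by
      have h1 := hval s k k k
      have h2 := leeTheta_of_horizontalCoords (S := S) b hF (!s) k
      simp only [Bool.not_not] at h2
      rw [← h2]
      simp only [if_true] at h1
      field_simp at h1
      linarith
    refine ⟨fun s => ⟨fun i j k => F (e (some (s, i))) (e (some (s, j))) (e (some (!s, k))),
      fun i j => ?_, ?_⟩, hF⟩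
    · funext k
      exact hsym s i j k
    · funext k
      rw [Finset.sum_apply]
      exact htr s k
  · rintro ⟨x, hF⟩
    refine ⟨he.admissible_of_horizontalCoords hF, ?_⟩
    have hsym (s : Bool) (i j k : Fin n) : (x s).1 i j k = (x s).1 j i k :=
      congrFun ((x s).2.1 i j) k
    have hθ (s k) : S.leeTheta b F (e (some (s, k))) = 0 := by
      rw [leeTheta_of_horizontalCoords b hF, ← Finset.sum_apply, (x (!s)).2.2]
      rfl
    rintro (_ | ⟨_ | _, i⟩) (_ | ⟨_ | _, j⟩) (_ | ⟨_ | _, k⟩) <;>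
      simp [comp2, comp1, he.phi_none, he.phi_true, he.phi_false, hF, horizontalCoords,
        leeTheta_neg, leeTheta_zero, hθ] <;>
      grind

lemma IsAdapted.class3_iff (he : S.IsAdapted e) :
    (S.Admissible F ∧ ∀ x y z, F x y z = S.comp3 F x y z) ↔
      ∃ x : Bool → skewFamilies (Fin n) (Fin n → ℝ), ∀ i j k,
        F (e i) (e j) (e k) = horizontalCoords (fun s => (x s).1) i j k := by
  rw [(S.isTrilinear_comp3 F).forall_eq_iff e.toBasis]
  simp only [OrthonormalBasis.coe_toBasis]
  constructor
  · rintro ⟨hadm, hc⟩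
    obtain ⟨hs, h0, -⟩ := he.admissible_iff.mp hadm
    have hs2 (a i j) : F (e a) (e (some (false, i))) (e (some (true, j))) =
      F (e a) (e (some (true, j))) (e (some (false, i))) := hs _ _ _
    have hn1 (j k) : F (e none) (e j) (e k) = 0 := by
      rw [hc]
      simp [comp3, he.phi_none]
    have hn3 (i j) : F (e i) (e j) (e none) = 0 := by
      rw [hc]
      simp [comp3, he.phi_none]
    have hskew (s : Bool) (i j k : Fin n) :
        F (e (some (s, i))) (e (some (s, j))) (e (some (!s, k))) =
          -F (e (some (s, j))) (e (some (s, i))) (e (some (!s, k))) := by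
      have h1 := hc (some (s, i)) (some (s, j)) (some (!s, k))
      cases s <;>
        simp [comp3, he.phi_true, he.phi_false, h0, hs2] at h1 ⊢ <;> linarith
    refine ⟨fun s => ⟨fun i j k => F (e (some (s, i))) (e (some (s, j))) (e (some (!s, k))),
      fun i j => ?_⟩, he.eq_horizontalCoords hadm hn1 hn3⟩
    funext k
    exact hskew s i j k
  · rintro ⟨x, hF⟩
    have hskew (s : Bool) (i j k : Fin n) : (x s).1 i j k = -(x s).1 j i k :=
      congrFun ((x s).2 i j) k
    refine ⟨he.admissible_of_horizontalCoords hF, ?_⟩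
    rintro (_ | ⟨_ | _, i⟩) (_ | ⟨_ | _, j⟩) (_ | ⟨_ | _, k⟩) <;>
      simp [comp3, he.phi_none, he.phi_true, he.phi_false, hF, horizontalCoords] <;>
      grind

/-- Coordinates of the tensors assembled from the values `F(x, y, ξ)` on pairs of eigenvectors
of `φ`. -/
def verticalCoords : (Bool → Bool → ι → ι → ℝ) →ₗ[ℝ]
    (Option (Bool × ι) → Option (Bool × ι) → Option (Bool × ι) → ℝ) where
  toFun B
    | some (s, i), some (t, j), none => B s t i j
    | some (s, i), none, some (t, j) => B s t i j
    | _, _, _ => 0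
  map_add' A B := by
    funext i j k
    rcases i with _ | i <;> rcases j with _ | j <;> rcases k with _ | k <;> simp
  map_smul' c A := by
    funext i j k
    rcases i with _ | i <;> rcases j with _ | j <;> rcases k with _ | k <;> simp

lemma verticalCoords_injective :
    Function.Injective (verticalCoords : (Bool → Bool → ι → ι → ℝ) →ₗ[ℝ] _) := by
  intro A B h
  funext s t i j
  exact congrFun (congrFun (congrFun h (some (s, i))) (some (t, j))) none

/-- Coordinates of the tensors assembled from the values `F(ξ, y, z)` on pairs of eigenvectors
of `φ` of opposite types. -/
def axialCoords : (ι → ι → ℝ) →ₗ[ℝ]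
    (Option (Bool × ι) → Option (Bool × ι) → Option (Bool × ι) → ℝ) where
  toFun C
    | none, some (true, i), some (false, j) => C i j
    | none, some (false, j), some (true, i) => C i j
    | _, _, _ => 0
  map_add' A B := by
    funext i j k
    rcases i with _ | i <;> rcases j with _ | ⟨_ | _, j⟩ <;> rcases k with _ | ⟨_ | _, k⟩ <;> simp
  map_smul' c A := by
    funext i j k
    rcases i with _ | i <;> rcases j with _ | ⟨_ | _, j⟩ <;> rcases k with _ | ⟨_ | _, k⟩ <;> simp

lemma axialCoords_injective :
    Function.Injective (axialCoords : (ι → ι → ℝ) →ₗ[ℝ] _) := by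
  intro A B h
  funext i j
  exact congrFun (congrFun (congrFun h none) (some (true, i))) (some (false, j))

/-- Coordinates of the tensors assembled from the values `F(ξ, ξ, z)` on eigenvectors of `φ`. -/
def leeCoords : (Bool × ι → ℝ) →ₗ[ℝ]
    (Option (Bool × ι) → Option (Bool × ι) → Option (Bool × ι) → ℝ) where
  toFun w
    | none, none, some p => w p
    | none, some p, none => w p
    | _, _, _ => 0
  map_add' A B := by
    funext i j k
    rcases i with _ | i <;> rcases j with _ | j <;> rcases k with _ | k <;> simp
  map_smul' c A := by
    funext i j k
    rcases i with _ | i <;> rcases j with _ | j <;> rcases k with _ | k <;> simp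

lemma leeCoords_injective :
    Function.Injective (leeCoords : (Bool × ι → ℝ) →ₗ[ℝ] _) := by
  intro A B h
  funext p
  exact congrFun (congrFun (congrFun h none) none) (some p)

lemma IsAdapted.admissible_of_verticalCoords (he : S.IsAdapted e)
    {B : Bool → Bool → Fin n → Fin n → ℝ}
    (hF : ∀ i j k, F (e i) (e j) (e k) = verticalCoords B i j k) : S.Admissible F := by
  rw [he.admissible_iff]
  simp only [hF]
  refine ⟨?_, ?_, ?_⟩
  · rintro (_ | i) (_ | j) (_ | k) <;> simp [verticalCoords]
  · rintro (_ | i) s j k <;> simp [verticalCoords]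
  · rintro (_ | i) <;> simp [verticalCoords]

lemma IsAdapted.eq_verticalCoords (he : S.IsAdapted e) (hF : S.Admissible F)
    (hn1 : ∀ j k, F (e none) (e j) (e k) = 0)
    (hn0 : ∀ p q r, F (e (some p)) (e (some q)) (e (some r)) = 0)
    (i j k : Option (Bool × Fin n)) :
    F (e i) (e j) (e k) = verticalCoords
      (fun s t i j => F (e (some (s, i))) (e (some (t, j))) (e none)) i j k := by
  obtain ⟨hs, -, hx⟩ := he.admissible_iff.mp hF
  have hs1 (a p) : F (e a) (e none) (e (some p)) = F (e a) (e (some p)) (e none) := hs _ _ _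
  rcases i with _ | i <;> rcases j with _ | j <;> rcases k with _ | k <;>
    simp [verticalCoords, hx, hn1, hn0, hs1]

lemma leeTheta_of_verticalCoords {B : Bool → Bool → Fin n → Fin n → ℝ}
    (hF : ∀ i j k, F (e i) (e j) (e k) = verticalCoords B i j k) :
    S.leeTheta b F (e none) = ∑ i, B true true i i + ∑ i, B false false i i := by
  rw [leeTheta_eq b e]
  simp [hF, verticalCoords]

lemma IsAdapted.leeThetaStar_of_verticalCoords (he : S.IsAdapted e)
    {B : Bool → Bool → Fin n → Fin n → ℝ}
    (hF : ∀ i j k, F (e i) (e j) (e k) = verticalCoords B i j k) :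
    S.leeThetaStar b F (e none) = ∑ i, B true true i i - ∑ i, B false false i i := by
  rw [he.leeThetaStar_eq b]
  simp [hF, verticalCoords]

lemma IsAdapted.class4_iff (hn : 1 ≤ n) (he : S.IsAdapted e) :
    (S.Admissible F ∧ ∀ x y z, F x y z = S.comp4 b F x y z) ↔
      ∃ x : ℝ, ∀ i j k, F (e i) (e j) (e k) =
        verticalCoords (fun s t i j => if s = t ∧ i = j then x else 0) i j k := by
  have hn0 : (n : ℝ) ≠ 0 := by positivity
  rw [(S.isTrilinear_comp4 b F).forall_eq_iff e.toBasis]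
  simp only [OrthonormalBasis.coe_toBasis]
  constructor
  · rintro ⟨-, hc⟩
    refine ⟨S.leeTheta b F S.xi / (2 * n), fun i j k => ?_⟩
    rw [hc]
    rcases i with _ | ⟨_ | _, i⟩ <;> rcases j with _ | ⟨_ | _, j⟩ <;>
      rcases k with _ | ⟨_ | _, k⟩ <;>
      simp [comp4, he.phi_none, he.phi_true, he.phi_false, e.inner_eq_ite, verticalCoords,
        he.eta_none, he.eta_some]
  · rintro ⟨x, hF⟩
    refine ⟨he.admissible_of_verticalCoords hF, ?_⟩
    have hθ : S.leeTheta b F S.xi = 2 * n * x := by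
      rw [← he.none_eq, leeTheta_of_verticalCoords b hF]
      simp
      ring
    rintro (_ | ⟨_ | _, i⟩) (_ | ⟨_ | _, j⟩) (_ | ⟨_ | _, k⟩) <;>
      simp [comp4, he.phi_none, he.phi_true, he.phi_false, hF, verticalCoords, e.inner_eq_ite,
        he.eta_none, he.eta_some, hθ, hn0]

lemma IsAdapted.class5_iff (hn : 1 ≤ n) (he : S.IsAdapted e) :
    (S.Admissible F ∧ ∀ x y z, F x y z = S.comp5 b F x y z) ↔
      ∃ x : ℝ, ∀ i j k, F (e i) (e j) (e k) =
        verticalCoords (fun s t i j => if s = t ∧ i = j then boolSign s * x else 0) i j k := by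
  have hn0 : (n : ℝ) ≠ 0 := by positivity
  rw [(S.isTrilinear_comp5 b F).forall_eq_iff e.toBasis]
  simp only [OrthonormalBasis.coe_toBasis]
  constructor
  · rintro ⟨-, hc⟩
    refine ⟨S.leeThetaStar b F S.xi / (2 * n), fun i j k => ?_⟩
    rw [hc]
    rcases i with _ | ⟨_ | _, i⟩ <;> rcases j with _ | ⟨_ | _, j⟩ <;>
      rcases k with _ | ⟨_ | _, k⟩ <;>
      simp [comp5, he.phi_none, he.phi_true, he.phi_false, e.inner_eq_ite, verticalCoords,
        he.eta_none, he.eta_some] <;>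
      split_ifs <;> simp
  · rintro ⟨x, hF⟩
    refine ⟨he.admissible_of_verticalCoords hF, ?_⟩
    have hθ : S.leeThetaStar b F S.xi = 2 * n * x := by
      rw [← he.none_eq, he.leeThetaStar_of_verticalCoords b hF]
      simp
      ring
    rintro (_ | ⟨_ | _, i⟩) (_ | ⟨_ | _, j⟩) (_ | ⟨_ | _, k⟩) <;>
      simp [comp5, he.phi_none, he.phi_true, he.phi_false, hF, verticalCoords, e.inner_eq_ite,
        he.eta_none, he.eta_some, hθ, hn0] <;>
      split_ifs <;> simp

lemma IsAdapted.class6_iff (hn : 1 ≤ n) (he : S.IsAdapted e) :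
    (S.Admissible F ∧ ∀ x y z, F x y z = S.comp6 b F x y z) ↔
      ∃ x : Bool → tracelessFamilies (Fin n) ℝ, ∀ i j k, F (e i) (e j) (e k) =
        verticalCoords (fun s t i j => if s = t then (x s).1 i j else 0) i j k := by
  have hn0 : (n : ℝ) ≠ 0 := by positivity
  rw [(S.isTrilinear_comp6 b F).forall_eq_iff e.toBasis]
  simp only [OrthonormalBasis.coe_toBasis]
  constructor
  · rintro ⟨hadm, hc⟩
    have hn1 (j k) : F (e none) (e j) (e k) = 0 := by
      rw [hc]
      rcases j with _ | ⟨_ | _, j⟩ <;> rcases k with _ | ⟨_ | _, k⟩ <;>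
        simp [comp6, comp4, comp5, he.phi_none, he.phi_true, he.phi_false, e.inner_eq_ite]
    have hn0 (p q r) : F (e (some p)) (e (some q)) (e (some r)) = 0 := by
      rw [hc]
      simp [comp6, comp4, comp5, he.eta_some]
    have hF := he.eq_verticalCoords hadm hn1 hn0
    have hoff {s t : Bool} (h : s ≠ t) (i j : Fin n) :
        F (e (some (s, i))) (e (some (t, j))) (e none) = 0 := by
      rw [hc]
      cases s <;> cases t <;> first
      | exact absurd rfl h
      | simp [comp6, comp4, comp5, he.phi_true, he.phi_false, he.eta_none, he.eta_some,
          e.inner_eq_ite]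
    have hval (s : Bool) (i j : Fin n) : F (e (some (s, i))) (e (some (s, j))) (e none) =
        (1 / 2) * (F (e (some (s, i))) (e (some (s, j))) (e none) +
          F (e (some (s, j))) (e (some (s, i))) (e none)) -
        if i = j then (1 / n) * ∑ l, F (e (some (s, l))) (e (some (s, l))) (e none) else 0 := by
      have h1 := hc (some (s, i)) (some (s, j)) none
      have h2 := leeTheta_of_verticalCoords (S := S) b hF
      have h3 := he.leeThetaStar_of_verticalCoords b hF
      cases s <;>
        simp [comp6, comp4, comp5, he.phi_none, he.phi_true, he.phi_false, he.eta_none,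
          he.eta_some, e.inner_eq_ite, ← he.none_eq, h2, h3] at h1 ⊢ <;>
        split_ifs at h1 ⊢ <;>
        first
        | linarith
        | field_simp at h1 ⊢; linarith
    have hsym (s : Bool) (i j : Fin n) : F (e (some (s, i))) (e (some (s, j))) (e none) =
        F (e (some (s, j))) (e (some (s, i))) (e none) := by
      have h1 := hval s i j
      have h2 := hval s j i
      simp only [eq_comm (a := j) (b := i)] at h2
      linarith
    have htr (s : Bool) : ∑ i, F (e (some (s, i))) (e (some (s, i))) (e none) = 0 := by
      have h1 := hval s ⟨0, hn⟩ ⟨0, hn⟩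
      simp only [if_true] at h1
      field_simp at h1
      linarith
    refine ⟨fun s => ⟨fun i j => F (e (some (s, i))) (e (some (s, j))) (e none), hsym s, htr s⟩,
      fun i j k => ?_⟩
    refine (hF i j k).trans (congrFun (congrFun (congrFun (congrArg verticalCoords ?_) i) j) k)
    funext s t i j
    split_ifs with h
    · subst h
      rfl
    · exact hoff h i j
  · rintro ⟨x, hF⟩
    refine ⟨he.admissible_of_verticalCoords hF, ?_⟩
    have hsym (s : Bool) (i j : Fin n) : (x s).1 i j = (x s).1 j i := (x s).2.1 i j
    have htr (s : Bool) : ∑ i, (x s).1 i i = 0 := (x s).2.2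
    have hθ : S.leeTheta b F (e none) = 0 := by
      rw [leeTheta_of_verticalCoords b hF]
      simp [htr]
    have hθ' : S.leeThetaStar b F (e none) = 0 := by
      rw [he.leeThetaStar_of_verticalCoords b hF]
      simp [htr]
    rintro (_ | ⟨_ | _, i⟩) (_ | ⟨_ | _, j⟩) (_ | ⟨_ | _, k⟩) <;>
      simp [comp6, comp4, comp5, he.phi_none, he.phi_true, he.phi_false, hF, verticalCoords,
        he.eta_none, he.eta_some, ← he.none_eq, hθ, hθ'] <;>
      grind

lemma IsAdapted.class7_iff (he : S.IsAdapted e) :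
    (S.Admissible F ∧ ∀ x y z, F x y z = S.comp7 F x y z) ↔
      ∃ x : Bool → skewFamilies (Fin n) ℝ, ∀ i j k, F (e i) (e j) (e k) =
        verticalCoords (fun s t i j => if s = t then (x s).1 i j else 0) i j k := by
  rw [(S.isTrilinear_comp7 F).forall_eq_iff e.toBasis]
  simp only [OrthonormalBasis.coe_toBasis]
  constructor
  · rintro ⟨hadm, hc⟩
    have hn1 (j k) : F (e none) (e j) (e k) = 0 := by
      rw [hc]
      rcases j with _ | ⟨_ | _, j⟩ <;> rcases k with _ | ⟨_ | _, k⟩ <;>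
        simp [comp7, he.phi_none, he.phi_true, he.phi_false]
    have hn0 (p q r) : F (e (some p)) (e (some q)) (e (some r)) = 0 := by
      rw [hc]
      simp [comp7, he.eta_some]
    have hF := he.eq_verticalCoords hadm hn1 hn0
    have hoff {s t : Bool} (h : s ≠ t) (i j : Fin n) :
        F (e (some (s, i))) (e (some (t, j))) (e none) = 0 := by
      rw [hc]
      cases s <;> cases t <;> first
      | exact absurd rfl h
      | simp [comp7, he.phi_true, he.phi_false, he.eta_none, he.eta_some]; ring
    have hskew (s : Bool) (i j : Fin n) : F (e (some (s, i))) (e (some (s, j))) (e none) =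
        -F (e (some (s, j))) (e (some (s, i))) (e none) := by
      have h1 := hc (some (s, i)) (some (s, j)) none
      cases s <;>
        simp [comp7, he.phi_none, he.phi_true, he.phi_false, he.eta_none, he.eta_some,
          ← he.none_eq] at h1 ⊢ <;>
        linarith
    refine ⟨fun s => ⟨fun i j => F (e (some (s, i))) (e (some (s, j))) (e none), hskew s⟩,
      fun i j k => ?_⟩
    refine (hF i j k).trans (congrFun (congrFun (congrFun (congrArg verticalCoords ?_) i) j) k)
    funext s t i j
    split_ifs with h
    · subst h
      rfl
    · exact hoff h i j
  · rintro ⟨x, hF⟩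
    refine ⟨he.admissible_of_verticalCoords hF, ?_⟩
    have hskew (s : Bool) (i j : Fin n) : (x s).1 i j = -(x s).1 j i := (x s).2 i j
    rintro (_ | ⟨_ | _, i⟩) (_ | ⟨_ | _, j⟩) (_ | ⟨_ | _, k⟩) <;>
      simp [comp7, he.phi_none, he.phi_true, he.phi_false, hF, verticalCoords,
        he.eta_none, he.eta_some, ← he.none_eq] <;>
      grind

lemma IsAdapted.class8_iff (he : S.IsAdapted e) :
    (S.Admissible F ∧ ∀ x y z, F x y z = S.comp8 F x y z) ↔
      ∃ x : Fin n → Fin n → ℝ, ∀ i j k, F (e i) (e j) (e k) =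
        verticalCoords (fun s t i j =>
          if s = t then 0 else if s then x i j else x j i) i j k := by
  rw [(S.isTrilinear_comp8 F).forall_eq_iff e.toBasis]
  simp only [OrthonormalBasis.coe_toBasis]
  constructor
  · rintro ⟨hadm, hc⟩
    have hn1 (j k) : F (e none) (e j) (e k) = 0 := by
      rw [hc]
      rcases j with _ | ⟨_ | _, j⟩ <;> rcases k with _ | ⟨_ | _, k⟩ <;>
        simp [comp8, he.phi_none, he.phi_true, he.phi_false]
    have hn0 (p q r) : F (e (some p)) (e (some q)) (e (some r)) = 0 := by
      rw [hc]
      simp [comp8, he.eta_some]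
    have hF := he.eq_verticalCoords hadm hn1 hn0
    have hdiag (s : Bool) (i j : Fin n) : F (e (some (s, i))) (e (some (s, j))) (e none) = 0 := by
      rw [hc]
      cases s <;>
        simp [comp8, he.phi_true, he.phi_false, he.eta_none, he.eta_some]
    have hoff (i j : Fin n) : F (e (some (false, i))) (e (some (true, j))) (e none) =
        F (e (some (true, j))) (e (some (false, i))) (e none) := by
      have h1 := hc (some (false, i)) (some (true, j)) none
      simp [comp8, he.phi_none, he.phi_true, he.phi_false, he.eta_none, he.eta_some,
        ← he.none_eq] at h1
      linarith
    refine ⟨fun i j => F (e (some (true, i))) (e (some (false, j))) (e none), fun i j k => ?_⟩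
    refine (hF i j k).trans (congrFun (congrFun (congrFun (congrArg verticalCoords ?_) i) j) k)
    funext s t i j
    cases s <;> cases t <;> simp [hoff, hdiag]
  · rintro ⟨x, hF⟩
    refine ⟨he.admissible_of_verticalCoords hF, ?_⟩
    rintro (_ | ⟨_ | _, i⟩) (_ | ⟨_ | _, j⟩) (_ | ⟨_ | _, k⟩) <;>
      simp [comp8, he.phi_none, he.phi_true, he.phi_false, hF, verticalCoords,
        he.eta_none, he.eta_some, ← he.none_eq] <;>
      grind

lemma IsAdapted.class9_iff (he : S.IsAdapted e) :
    (S.Admissible F ∧ ∀ x y z, F x y z = S.comp9 F x y z) ↔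
      ∃ x : Fin n → Fin n → ℝ, ∀ i j k, F (e i) (e j) (e k) =
        verticalCoords (fun s t i j =>
          if s = t then 0 else if s then x i j else -x j i) i j k := by
  rw [(S.isTrilinear_comp9 F).forall_eq_iff e.toBasis]
  simp only [OrthonormalBasis.coe_toBasis]
  constructor
  · rintro ⟨hadm, hc⟩
    have hn1 (j k) : F (e none) (e j) (e k) = 0 := by
      rw [hc]
      rcases j with _ | ⟨_ | _, j⟩ <;> rcases k with _ | ⟨_ | _, k⟩ <;>
        simp [comp9, he.phi_none, he.phi_true, he.phi_false]
    have hn0 (p q r) : F (e (some p)) (e (some q)) (e (some r)) = 0 := by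
      rw [hc]
      simp [comp9, he.eta_some]
    have hF := he.eq_verticalCoords hadm hn1 hn0
    have hdiag (s : Bool) (i j : Fin n) : F (e (some (s, i))) (e (some (s, j))) (e none) = 0 := by
      rw [hc]
      cases s <;>
        simp [comp9, he.phi_true, he.phi_false, he.eta_none, he.eta_some]
    have hoff (i j : Fin n) : F (e (some (false, i))) (e (some (true, j))) (e none) =
        -F (e (some (true, j))) (e (some (false, i))) (e none) := by
      have h1 := hc (some (false, i)) (some (true, j)) none
      simp [comp9, he.phi_none, he.phi_true, he.phi_false, he.eta_none, he.eta_some,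
        ← he.none_eq] at h1
      linarith
    refine ⟨fun i j => F (e (some (true, i))) (e (some (false, j))) (e none), fun i j k => ?_⟩
    refine (hF i j k).trans (congrFun (congrFun (congrFun (congrArg verticalCoords ?_) i) j) k)
    funext s t i j
    cases s <;> cases t <;> simp [hoff, hdiag]
  · rintro ⟨x, hF⟩
    refine ⟨he.admissible_of_verticalCoords hF, ?_⟩
    rintro (_ | ⟨_ | _, i⟩) (_ | ⟨_ | _, j⟩) (_ | ⟨_ | _, k⟩) <;>
      simp [comp9, he.phi_none, he.phi_true, he.phi_false, hF, verticalCoords,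
        he.eta_none, he.eta_some, ← he.none_eq] <;>
      grind

lemma IsAdapted.class10_iff (he : S.IsAdapted e) :
    (S.Admissible F ∧ ∀ x y z, F x y z = S.comp10 F x y z) ↔
      ∃ x : Fin n → Fin n → ℝ, ∀ i j k, F (e i) (e j) (e k) = axialCoords x i j k := by
  rw [he.admissible_iff, (S.isTrilinear_comp10 F).forall_eq_iff e.toBasis]
  simp only [OrthonormalBasis.coe_toBasis]
  constructor
  · rintro ⟨⟨hs, h0, hx⟩, hc⟩
    have hs2 (a i j) : F (e a) (e (some (false, i))) (e (some (true, j))) =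
      F (e a) (e (some (true, j))) (e (some (false, i))) := hs _ _ _
    have hn0 (p j k) : F (e (some p)) (e j) (e k) = 0 := by
      rw [hc]
      simp [comp10, he.eta_some]
    have hn2 (i k) : F (e i) (e none) (e k) = 0 := by
      rw [hc]
      simp [comp10, he.phi_none]
    have hn3 (i j) : F (e i) (e j) (e none) = 0 := by
      rw [hs, hn2]
    refine ⟨fun i j => F (e none) (e (some (true, i))) (e (some (false, j))), ?_⟩
    rintro (_ | i) (_ | ⟨_ | _, j⟩) (_ | ⟨_ | _, k⟩) <;>
      simp [axialCoords, h0, hn0, hn2, hn3, hs2]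
  · rintro ⟨x, hF⟩
    simp only [hF]
    refine ⟨⟨?_, ?_, ?_⟩, ?_⟩
    · rintro (_ | i) (_ | ⟨_ | _, j⟩) (_ | ⟨_ | _, k⟩) <;> simp [axialCoords]
    · rintro (_ | i) (_ | _) j k <;> simp [axialCoords]
    · rintro (_ | i) <;> simp [axialCoords]
    · rintro (_ | i) (_ | ⟨_ | _, j⟩) (_ | ⟨_ | _, k⟩) <;>
        simp [comp10, he.phi_none, he.phi_true, he.phi_false, hF, axialCoords, he.eta_none,
          he.eta_some, ← he.none_eq]

lemma IsAdapted.class11_iff (he : S.IsAdapted e) :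
    (S.Admissible F ∧ ∀ x y z, F x y z = S.comp11 F x y z) ↔
      ∃ w : Bool × Fin n → ℝ, ∀ i j k, F (e i) (e j) (e k) = leeCoords w i j k := by
  rw [he.admissible_iff, (S.isTrilinear_comp11 F).forall_eq_iff e.toBasis]
  simp only [OrthonormalBasis.coe_toBasis]
  constructor
  · rintro ⟨⟨hs, -, hx⟩, hc⟩
    have hn0 (p j k) : F (e (some p)) (e j) (e k) = 0 := by
      rw [hc]
      simp [comp11, he.eta_some]
    have hn3 (i p q) : F (e i) (e (some p)) (e (some q)) = 0 := by
      rw [hc]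
      simp [comp11, he.eta_some]
    have hs1 (a p) : F (e a) (e (some p)) (e none) = F (e a) (e none) (e (some p)) := hs _ _ _
    refine ⟨fun p => F (e none) (e none) (e (some p)), ?_⟩
    rintro (_ | i) (_ | j) (_ | k) <;> simp [leeCoords, hx, hn0, hn3, hs1]
  · rintro ⟨w, hF⟩
    simp only [hF]
    refine ⟨⟨?_, ?_, ?_⟩, ?_⟩
    · rintro (_ | i) (_ | j) (_ | k) <;> simp [leeCoords]
    · rintro (_ | i) s j k <;> simp [leeCoords]
    · rintro (_ | i) <;> simp [leeCoords]
    · rintro (_ | i) (_ | j) (_ | k) <;>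
        simp [comp11, leeOmega, hF, leeCoords, he.eta_none, he.eta_some, ← he.none_eq]

/-- Horizontal coefficients which are pure trace in the first two indices. -/
def pureTraceFamilies : (Bool → Fin n → ℝ) →ₗ[ℝ] (Bool → Fin n → Fin n → Fin n → ℝ) where
  toFun v s i j k := if i = j then v s k else 0
  map_add' v w := by
    funext s i j k
    by_cases h : i = j <;> simp [h]
  map_smul' c v := by
    funext s i j k
    by_cases h : i = j <;> simp [h]

lemma pureTraceFamilies_injective : Function.Injective (pureTraceFamilies (n := n)) := by
  intro v w h
  funext s k
  simpa [pureTraceFamilies] using congrFun (congrFun (congrFun (congrFun h s) k) k) k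

/-- The inclusion of pairs of members of a subspace into pairs. -/
def subtypePair {E : Type*} [AddCommGroup E] [Module ℝ E] (W : Submodule ℝ E) :
    (Bool → W) →ₗ[ℝ] (Bool → E) :=
  W.subtype.compLeft Bool

lemma subtypePair_injective {E : Type*} [AddCommGroup E] [Module ℝ E] (W : Submodule ℝ E) :
    Function.Injective (subtypePair W) := by
  intro x y h
  funext s
  exact Subtype.ext (congrFun h s)

/-- Vertical coefficients given by a multiple of the identity on each eigenspace of `φ`. -/
def scalarPairing (c : Bool → ℝ) : ℝ →ₗ[ℝ] (Bool → Bool → Fin n → Fin n → ℝ) where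
  toFun x s t i j := if s = t ∧ i = j then c s * x else 0
  map_add' x y := by
    funext s t i j
    by_cases h : s = t ∧ i = j <;> simp [h, mul_add]
  map_smul' a x := by
    funext s t i j
    by_cases h : s = t ∧ i = j <;> simp [h, mul_left_comm]

lemma scalarPairing_injective (hn : 1 ≤ n) {c : Bool → ℝ} (hc : c true ≠ 0) :
    Function.Injective (scalarPairing (n := n) c) := by
  intro x y h
  simpa [scalarPairing, hc] using
    congrFun (congrFun (congrFun (congrFun h true) true) ⟨0, hn⟩) ⟨0, hn⟩

/-- Vertical coefficients supported on pairs of eigenvectors of the same type. -/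
def diagonalPairing : (Bool → Fin n → Fin n → ℝ) →ₗ[ℝ] (Bool → Bool → Fin n → Fin n → ℝ) where
  toFun x s t i j := if s = t then x s i j else 0
  map_add' x y := by
    funext s t i j
    by_cases h : s = t <;> simp [h]
  map_smul' a x := by
    funext s t i j
    by_cases h : s = t <;> simp [h]

lemma diagonalPairing_injective : Function.Injective (diagonalPairing (n := n)) := by
  intro x y h
  funext s i j
  simpa [diagonalPairing] using congrFun (congrFun (congrFun (congrFun h s) s) i) j

/-- Vertical coefficients supported on pairs of eigenvectors of opposite types, those in the two
orders being related by the factor `c`. -/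
def mixedPairing (c : ℝ) : (Fin n → Fin n → ℝ) →ₗ[ℝ] (Bool → Bool → Fin n → Fin n → ℝ) where
  toFun x s t i j := if s = t then 0 else if s then x i j else c * x j i
  map_add' x y := by
    funext s t i j
    cases s <;> cases t <;> simp [mul_add]
  map_smul' a x := by
    funext s t i j
    cases s <;> cases t <;> simp [mul_left_comm]

lemma mixedPairing_injective (c : ℝ) : Function.Injective (mixedPairing (n := n) c) := by
  intro x y h
  funext i j
  simpa [mixedPairing] using congrFun (congrFun (congrFun (congrFun h true) false) i) j

lemma finrank_bool_fun (E : Type*) [AddCommGroup E] [Module ℝ E] [FiniteDimensional ℝ E] :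
    Module.finrank ℝ (Bool → E) = 2 * Module.finrank ℝ E := by
  rw [Module.finrank_pi_fintype]
  simp [two_mul]

lemma finrank_bool_skewFamilies (E : Type*) [AddCommGroup E] [Module ℝ E]
    [FiniteDimensional ℝ E] :
    Module.finrank ℝ (Bool → skewFamilies (Fin n) E) = n * (n - 1) * Module.finrank ℝ E := by
  rw [finrank_bool_fun, finrank_skewFamilies, Fintype.card_fin, ← mul_assoc, mul_comm 2,
    Nat.choose_two_right, Nat.div_mul_cancel (Nat.even_mul_pred_self n).two_dvd]

lemma finrank_bool_tracelessFamilies (hn : 1 ≤ n) (E : Type*) [AddCommGroup E] [Module ℝ E]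
    [FiniteDimensional ℝ E] :
    Module.finrank ℝ (Bool → tracelessFamilies (Fin n) E) =
      (n - 1) * (n + 2) * Module.finrank ℝ E := by
  obtain ⟨m, rfl⟩ := Nat.exists_eq_add_of_le' hn
  have h := finrank_tracelessFamilies (Fin (m + 1)) E
  have h2 : (m + 1 + 1).choose 2 * 2 = (m + 1 + 1) * (m + 1) := by
    rw [Nat.choose_two_right, Nat.div_mul_cancel (Nat.even_mul_pred_self _).two_dvd]
    rfl
  rw [Fintype.card_fin] at h
  rw [finrank_bool_fun, Nat.add_sub_cancel]
  have h3 : 2 * (Module.finrank ℝ (tracelessFamilies (Fin (m + 1)) E) + Module.finrank ℝ E) =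
      (m + 1 + 1) * (m + 1) * Module.finrank ℝ E := by
    rw [h, ← h2]
    ring
  nlinarith

lemma finrank_square : Module.finrank ℝ (Fin n → Fin n → ℝ) = n ^ 2 := by
  simp [Module.finrank_pi_fintype, sq]

end APAP

end Classes

/-- the dimensions of the subspaces `𝔽ᵢ`. -/
theorem statement9 (hn : 1 ≤ n) (S : APAP n V)
    (b : OrthonormalBasis (Fin (2 * n + 1)) ℝ V) :
  (∃ W : Submodule ℝ (V →ₗ[ℝ] V →ₗ[ℝ] V →ₗ[ℝ] ℝ),
      (W : Set (V →ₗ[ℝ] V →ₗ[ℝ] V →ₗ[ℝ] ℝ)) =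
        {F : V →ₗ[ℝ] V →ₗ[ℝ] V →ₗ[ℝ] ℝ | S.Admissible F ∧ ∀ x y z : V, F x y z = S.comp1 b F x y z} ∧
      Module.finrank ℝ W = 2 * n) ∧
  (∃ W : Submodule ℝ (V →ₗ[ℝ] V →ₗ[ℝ] V →ₗ[ℝ] ℝ),
      (W : Set (V →ₗ[ℝ] V →ₗ[ℝ] V →ₗ[ℝ] ℝ)) =
        {F : V →ₗ[ℝ] V →ₗ[ℝ] V →ₗ[ℝ] ℝ | S.Admissible F ∧ ∀ x y z : V, F x y z = S.comp2 b F x y z} ∧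
      Module.finrank ℝ W = n * (n - 1) * (n + 2)) ∧
  (∃ W : Submodule ℝ (V →ₗ[ℝ] V →ₗ[ℝ] V →ₗ[ℝ] ℝ),
      (W : Set (V →ₗ[ℝ] V →ₗ[ℝ] V →ₗ[ℝ] ℝ)) =
        {F : V →ₗ[ℝ] V →ₗ[ℝ] V →ₗ[ℝ] ℝ | S.Admissible F ∧ ∀ x y z : V, F x y z = S.comp3 F x y z} ∧
      Module.finrank ℝ W = n ^ 2 * (n - 1)) ∧
  (∃ W : Submodule ℝ (V →ₗ[ℝ] V →ₗ[ℝ] V →ₗ[ℝ] ℝ),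
      (W : Set (V →ₗ[ℝ] V →ₗ[ℝ] V →ₗ[ℝ] ℝ)) =
        {F : V →ₗ[ℝ] V →ₗ[ℝ] V →ₗ[ℝ] ℝ | S.Admissible F ∧ ∀ x y z : V, F x y z = S.comp4 b F x y z} ∧
      Module.finrank ℝ W = 1) ∧
  (∃ W : Submodule ℝ (V →ₗ[ℝ] V →ₗ[ℝ] V →ₗ[ℝ] ℝ),
      (W : Set (V →ₗ[ℝ] V →ₗ[ℝ] V →ₗ[ℝ] ℝ)) =
        {F : V →ₗ[ℝ] V →ₗ[ℝ] V →ₗ[ℝ] ℝ | S.Admissible F ∧ ∀ x y z : V, F x y z = S.comp5 b F x y z} ∧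
      Module.finrank ℝ W = 1) ∧
  (∃ W : Submodule ℝ (V →ₗ[ℝ] V →ₗ[ℝ] V →ₗ[ℝ] ℝ),
      (W : Set (V →ₗ[ℝ] V →ₗ[ℝ] V →ₗ[ℝ] ℝ)) =
        {F : V →ₗ[ℝ] V →ₗ[ℝ] V →ₗ[ℝ] ℝ | S.Admissible F ∧ ∀ x y z : V, F x y z = S.comp6 b F x y z} ∧
      Module.finrank ℝ W = (n - 1) * (n + 2)) ∧
  (∃ W : Submodule ℝ (V →ₗ[ℝ] V →ₗ[ℝ] V →ₗ[ℝ] ℝ),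
      (W : Set (V →ₗ[ℝ] V →ₗ[ℝ] V →ₗ[ℝ] ℝ)) =
        {F : V →ₗ[ℝ] V →ₗ[ℝ] V →ₗ[ℝ] ℝ | S.Admissible F ∧ ∀ x y z : V, F x y z = S.comp7 F x y z} ∧
      Module.finrank ℝ W = n * (n - 1)) ∧
  (∃ W : Submodule ℝ (V →ₗ[ℝ] V →ₗ[ℝ] V →ₗ[ℝ] ℝ),
      (W : Set (V →ₗ[ℝ] V →ₗ[ℝ] V →ₗ[ℝ] ℝ)) =
        {F : V →ₗ[ℝ] V →ₗ[ℝ] V →ₗ[ℝ] ℝ | S.Admissible F ∧ ∀ x y z : V, F x y z = S.comp8 F x y z} ∧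
      Module.finrank ℝ W = n ^ 2) ∧
  (∃ W : Submodule ℝ (V →ₗ[ℝ] V →ₗ[ℝ] V →ₗ[ℝ] ℝ),
      (W : Set (V →ₗ[ℝ] V →ₗ[ℝ] V →ₗ[ℝ] ℝ)) =
        {F : V →ₗ[ℝ] V →ₗ[ℝ] V →ₗ[ℝ] ℝ | S.Admissible F ∧ ∀ x y z : V, F x y z = S.comp9 F x y z} ∧
      Module.finrank ℝ W = n ^ 2) ∧
  (∃ W : Submodule ℝ (V →ₗ[ℝ] V →ₗ[ℝ] V →ₗ[ℝ] ℝ),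
      (W : Set (V →ₗ[ℝ] V →ₗ[ℝ] V →ₗ[ℝ] ℝ)) =
        {F : V →ₗ[ℝ] V →ₗ[ℝ] V →ₗ[ℝ] ℝ | S.Admissible F ∧ ∀ x y z : V, F x y z = S.comp10 F x y z} ∧
      Module.finrank ℝ W = n ^ 2) ∧
  (∃ W : Submodule ℝ (V →ₗ[ℝ] V →ₗ[ℝ] V →ₗ[ℝ] ℝ),
      (W : Set (V →ₗ[ℝ] V →ₗ[ℝ] V →ₗ[ℝ] ℝ)) =
        {F : V →ₗ[ℝ] V →ₗ[ℝ] V →ₗ[ℝ] ℝ | S.Admissible F ∧ ∀ x y z : V, F x y z = S.comp11 F x y z} ∧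
      Module.finrank ℝ W = 2 * n) := by
  obtain ⟨e, he⟩ := S.exists_isAdapted
  refine ⟨?_, ?_, ?_, ?_, ?_, ?_, ?_, ?_, ?_, ?_, ?_⟩
  · refine exists_submodule_of_coords e.toBasis
      (APAP.horizontalCoords ∘ₗ APAP.pureTraceFamilies)
      (APAP.horizontalCoords_injective.comp APAP.pureTraceFamilies_injective) ?_ _
      fun F => by rw [OrthonormalBasis.coe_toBasis]; exact he.class1_iff b hn
    simp [APAP.finrank_bool_fun]
  · refine exists_submodule_of_coords e.toBasis
      (APAP.horizontalCoords ∘ₗ APAP.subtypePair (tracelessFamilies (Fin n) (Fin n → ℝ)))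
      (APAP.horizontalCoords_injective.comp (APAP.subtypePair_injective _)) ?_ _
      fun F => by rw [OrthonormalBasis.coe_toBasis]; exact he.class2_iff b hn
    rw [APAP.finrank_bool_tracelessFamilies hn, Module.finrank_fin_fun]
    ring
  · refine exists_submodule_of_coords e.toBasis
      (APAP.horizontalCoords ∘ₗ APAP.subtypePair (skewFamilies (Fin n) (Fin n → ℝ)))
      (APAP.horizontalCoords_injective.comp (APAP.subtypePair_injective _)) ?_ _
      fun F => by rw [OrthonormalBasis.coe_toBasis]; exact he.class3_iff
    rw [APAP.finrank_bool_skewFamilies, Module.finrank_fin_fun]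
    ring
  · refine exists_submodule_of_coords e.toBasis
      (APAP.verticalCoords ∘ₗ APAP.scalarPairing fun _ => 1)
      (APAP.verticalCoords_injective.comp (APAP.scalarPairing_injective hn one_ne_zero)) ?_ _
      fun F => by simpa [APAP.scalarPairing] using he.class4_iff b hn
    exact Module.finrank_self ℝ
  · refine exists_submodule_of_coords e.toBasis
      (APAP.verticalCoords ∘ₗ APAP.scalarPairing boolSign)
      (APAP.verticalCoords_injective.comp
        (APAP.scalarPairing_injective hn (by simp [boolSign]))) ?_ _
      fun F => by simpa [APAP.scalarPairing] using he.class5_iff b hn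
    exact Module.finrank_self ℝ
  · refine exists_submodule_of_coords e.toBasis
      (APAP.verticalCoords ∘ₗ APAP.diagonalPairing ∘ₗ
        APAP.subtypePair (tracelessFamilies (Fin n) ℝ))
      (APAP.verticalCoords_injective.comp
        (APAP.diagonalPairing_injective.comp (APAP.subtypePair_injective _))) ?_ _
      fun F => by rw [OrthonormalBasis.coe_toBasis]; exact he.class6_iff b hn
    simp [APAP.finrank_bool_tracelessFamilies hn]
  · refine exists_submodule_of_coords e.toBasis
      (APAP.verticalCoords ∘ₗ APAP.diagonalPairing ∘ₗ
        APAP.subtypePair (skewFamilies (Fin n) ℝ))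
      (APAP.verticalCoords_injective.comp
        (APAP.diagonalPairing_injective.comp (APAP.subtypePair_injective _))) ?_ _
      fun F => by rw [OrthonormalBasis.coe_toBasis]; exact he.class7_iff
    simp [APAP.finrank_bool_skewFamilies]
  · refine exists_submodule_of_coords e.toBasis
      (APAP.verticalCoords ∘ₗ APAP.mixedPairing 1)
      (APAP.verticalCoords_injective.comp (APAP.mixedPairing_injective 1)) ?_ _
      fun F => by simpa [APAP.mixedPairing] using he.class8_iff
    exact APAP.finrank_square
  · refine exists_submodule_of_coords e.toBasis
      (APAP.verticalCoords ∘ₗ APAP.mixedPairing (-1))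
      (APAP.verticalCoords_injective.comp (APAP.mixedPairing_injective (-1))) ?_ _
      fun F => by simpa [APAP.mixedPairing] using he.class9_iff
    exact APAP.finrank_square
  · refine exists_submodule_of_coords e.toBasis APAP.axialCoords
      APAP.axialCoords_injective ?_ _
      fun F => by simpa using he.class10_iff
    exact APAP.finrank_square
  · refine exists_submodule_of_coords e.toBasis APAP.leeCoords
      APAP.leeCoords_injective ?_ _
      fun F => by simpa using he.class11_iff
    simp
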